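/- Let (X,d) be a strongly geodesic δ-hyperbolic G-space with δ > 0, let g ∈ G, let C = ⟨g⟩ ≤ G, and suppose the asymptotic translation length satisfies ‖g‖_∞ = c > 0 (so that Λ(C) consists of two distinct points and the weak convex hull X_C is defined). Then the small displacement set E(g) = {x ∈ X : d(x, gx) ≤ 100δ} is contained in the closed k-neighborhood of X_C, where k = 5000δ²/c + 50δ. -/

import Mathlib

noncomputable section

namespace KW

open Metric Set Pointwise

variable {X : Type*} [MetricSpace X]

/-- `s` is (the image of) a unit-speed geodesic segment joining `x` to `y`. -/
def IsGeodesicSegment (s : Set X) (x y : X) : Prop :=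
  ∃ (b : ℝ) (f : ℝ → X), 0 ≤ b ∧ f 0 = x ∧ f b = y ∧
    (∀ u ∈ Set.Icc (0 : ℝ) b, ∀ v ∈ Set.Icc (0 : ℝ) b, dist (f u) (f v) = |u - v|) ∧
    s = f '' Set.Icc 0 b

/-- A geodesic metric space. -/
def GeodesicSpace (X : Type*) [MetricSpace X] : Prop :=
  ∀ x y : X, ∃ s : Set X, IsGeodesicSegment s x y

/-- `X` is `δ`-hyperbolic: geodesic, and every geodesic triangle is `δ`-thin. -/
def DeltaHyperbolic (δ : ℝ) (X : Type*) [MetricSpace X] : Prop :=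
  GeodesicSpace X ∧
    ∀ (x y z : X) (s₁ s₂ s₃ : Set X),
      IsGeodesicSegment s₁ x y → IsGeodesicSegment s₂ y z → IsGeodesicSegment s₃ x z →
      ∀ p ∈ s₁, ∃ q ∈ s₂ ∪ s₃, dist p q ≤ δ

/-- `A` is an `ε`-quasiconvex subset of `X`. -/
def Quasiconvex (ε : ℝ) (A : Set X) : Prop :=
  ∀ x ∈ A, ∀ y ∈ A, ∀ s : Set X, IsGeodesicSegment s x y → ∀ p ∈ s, ∃ a ∈ A, dist p a ≤ ε

/-- The Gromov product `(y,z)_x`. -/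
def gromov (x y z : X) : ℝ := (dist y x + dist z x - dist y z) / 2

def IsGeodesicRay (γ : ℝ → X) : Prop :=
  ∀ s t : ℝ, 0 ≤ s → 0 ≤ t → dist (γ s) (γ t) = |s - t|

def IsBiGeodesic (γ : ℝ → X) : Prop :=
  ∀ s t : ℝ, dist (γ s) (γ t) = |s - t|

/-- `A` and `B` are `K`-Hausdorff close. -/
def HClose (K : ℝ) (A B : Set X) : Prop :=
  (∀ a ∈ A, ∃ b ∈ B, dist a b ≤ K) ∧ ∀ b ∈ B, ∃ a ∈ A, dist a b ≤ K

def HausdorffClose (A B : Set X) : Prop := ∃ K : ℝ, HClose K A B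

/-- Two geodesic rays are asymptotic iff their images are Hausdorff close. -/
def Asymptotic (γ γ' : ℝ → X) : Prop :=
  HausdorffClose (γ '' Set.Ici 0) (γ' '' Set.Ici 0)

def GRay (X : Type*) [MetricSpace X] : Type _ := {γ : ℝ → X // IsGeodesicRay γ}

theorem asymptotic_refl (γ : ℝ → X) : Asymptotic γ γ :=
  ⟨0, fun a ha => ⟨a, ha, by simp⟩, fun b hb => ⟨b, hb, by simp⟩⟩

theorem asymptotic_symm {γ γ' : ℝ → X} (h : Asymptotic γ γ') : Asymptotic γ' γ := by
  obtain ⟨K, h₁, h₂⟩ := h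
  refine ⟨K, fun a ha => ?_, fun b hb => ?_⟩
  · obtain ⟨b, hb, hd⟩ := h₂ a ha
    exact ⟨b, hb, by rwa [dist_comm]⟩
  · obtain ⟨a, ha, hd⟩ := h₁ b hb
    exact ⟨a, ha, by rwa [dist_comm]⟩

theorem asymptotic_trans {γ₁ γ₂ γ₃ : ℝ → X} (h : Asymptotic γ₁ γ₂)
    (h' : Asymptotic γ₂ γ₃) : Asymptotic γ₁ γ₃ := by
  obtain ⟨K, h₁, h₂⟩ := h
  obtain ⟨K', h₁', h₂'⟩ := h'
  refine ⟨K + K', fun a ha => ?_, fun c hc => ?_⟩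
  · obtain ⟨b, hb, hab⟩ := h₁ a ha
    obtain ⟨c, hc, hbc⟩ := h₁' b hb
    exact ⟨c, hc, (dist_triangle a b c).trans (by linarith)⟩
  · obtain ⟨b, hb, hbc⟩ := h₂' c hc
    obtain ⟨a, ha, hab⟩ := h₂ b hb
    exact ⟨a, ha, (dist_triangle a b c).trans (by linarith)⟩

def raySetoid (X : Type*) [MetricSpace X] : Setoid (GRay X) where
  r γ γ' := Asymptotic γ.1 γ'.1
  iseqv := ⟨fun γ => asymptotic_refl γ.1, fun h => asymptotic_symm h,
    fun h h' => asymptotic_trans h h'⟩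

/-- The (geodesic) boundary of `X`: asymptoty classes of geodesic rays. -/
def Boundary (X : Type*) [MetricSpace X] : Type _ := Quotient (raySetoid X)

def Boundary.mk {X : Type*} [MetricSpace X] (γ : GRay X) : Boundary X :=
  Quotient.mk (raySetoid X) γ

/-- A strongly geodesic metric space. -/
def StronglyGeodesic (X : Type*) [MetricSpace X] : Prop :=
  GeodesicSpace X ∧
  (∀ γ : ℝ → X, IsGeodesicRay γ → ∀ y : X,
      ∃ γ' : ℝ → X, IsGeodesicRay γ' ∧ γ' 0 = y ∧ Asymptotic γ γ') ∧
  (∀ γ₁ γ₂ : ℝ → X, IsGeodesicRay γ₁ → IsGeodesicRay γ₂ → γ₁ 0 = γ₂ 0 →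
      ¬ Asymptotic γ₁ γ₂ →
      ∃ γ : ℝ → X, IsBiGeodesic γ ∧
        HausdorffClose (Set.range γ) (γ₁ '' Set.Ici 0 ∪ γ₂ '' Set.Ici 0)) ∧
  (∀ (x : X) (u : ℕ → X),
      (∀ M : ℝ, ∃ N : ℕ, ∀ n, N ≤ n → ∀ m, N ≤ m → M ≤ gromov x (u n) (u m)) →
      ∃ γ : ℝ → X, IsGeodesicRay γ ∧ γ 0 = x ∧
        ∀ M : ℝ, ∃ N : ℕ, ∀ n, N ≤ n → ∀ m, N ≤ m → M ≤ gromov x (γ (n : ℝ)) (u m))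

/-- The sequence `u` converges to the boundary point `p`, with basepoint `x`. -/
def SeqConvTo (x : X) (u : ℕ → X) (p : Boundary X) : Prop :=
  ∃ γ : GRay X, Boundary.mk γ = p ∧
    ∀ M : ℝ, ∃ N : ℕ, ∀ n, N ≤ n → ∀ m, N ≤ m → M ≤ gromov x (u n) (γ.1 (m : ℝ))

/-- `γ` is a geodesic ray in the class of the boundary point `p`. -/
def RayTo (γ : ℝ → X) (p : Boundary X) : Prop :=
  ∃ h : IsGeodesicRay γ, Boundary.mk ⟨γ, h⟩ = p

/-- `γ` is a biinfinite geodesic whose two ends converge to `p` and `q`. -/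
def BiGeodesicJoins (γ : ℝ → X) (p q : Boundary X) : Prop :=
  IsBiGeodesic γ ∧ SeqConvTo (γ 0) (fun n => γ (-(n : ℝ))) p ∧
    SeqConvTo (γ 0) (fun n => γ (n : ℝ)) q

/-- `s` is (the image of) a geodesic joining two points of `X ∪ ∂X`. -/
def JoinSet : X ⊕ Boundary X → X ⊕ Boundary X → Set X → Prop
  | Sum.inl x, Sum.inl y, s => IsGeodesicSegment s x y
  | Sum.inl x, Sum.inr p, s => ∃ γ : ℝ → X, γ 0 = x ∧ RayTo γ p ∧ s = γ '' Set.Ici 0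
  | Sum.inr p, Sum.inl x, s => ∃ γ : ℝ → X, γ 0 = x ∧ RayTo γ p ∧ s = γ '' Set.Ici 0
  | Sum.inr p, Sum.inr q, s => ∃ γ : ℝ → X, BiGeodesicJoins γ p q ∧ s = Set.range γ

/-- The convex hull `Conv(A)` of a subset `A ⊆ X ∪ ∂X`. -/
def geoConv (A : Set (X ⊕ Boundary X)) : Set X :=
  {x | (∃ a : X, A = {Sum.inl a} ∧ x = a) ∨
    ∃ p ∈ A, ∃ q ∈ A, p ≠ q ∧ ∃ s : Set X, JoinSet p q s ∧ x ∈ s}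

/-- The distance between two subsets of `X`. -/
def setDist (A B : Set X) : ℝ := sInf (Set.image2 dist A B)

/-- `a` is a projection of `p` on `A` (relative to `δ`). -/
def IsProjection (δ : ℝ) (A : Set X) (p a : X) : Prop :=
  a ∈ A ∧ ∀ a' ∈ A, dist p a ≤ dist p a' + δ

/-- `f` restricted to `[0,L]` is a unit-speed geodesic from `x` to `y`. -/
def GeodParam (f : ℝ → X) (L : ℝ) (x y : X) : Prop :=
  0 ≤ L ∧ f 0 = x ∧ f L = y ∧
    ∀ u ∈ Set.Icc (0 : ℝ) L, ∀ v ∈ Set.Icc (0 : ℝ) L, dist (f u) (f v) = |u - v|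

/-- Concatenation of three paths, the first on `[0,a]`, the second on `[0,b]`. -/
def concat3 (f₁ f₂ f₃ : ℝ → X) (a b : ℝ) : ℝ → X := fun t =>
  if t ≤ a then f₁ t else if t ≤ a + b then f₂ (t - a) else f₃ (t - a - b)

/-- `f` is a `(lam, ε)`-quasigeodesic on `[a,b]`. -/
def QuasigeodesicOn (lam ε : ℝ) (f : ℝ → X) (a b : ℝ) : Prop :=
  ∀ s ∈ Set.Icc a b, ∀ t ∈ Set.Icc a b, |s - t| ≤ lam * dist (f s) (f t) + ε

/-- The action of `G` on `X` is by isometries. -/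
def IsometricAction (G Y : Type*) [Group G] [MetricSpace Y] [MulAction G Y] : Prop :=
  ∀ (g : G) (x y : Y), dist (g • x) (g • y) = dist x y

section GroupAction

variable {G : Type*} [Group G]

/-- The limit set `Λ(U) ⊆ ∂X` of a subgroup `U ≤ G`. -/
def limitSet (X : Type*) [MetricSpace X] [MulAction G X] (U : Subgroup G) :
    Set (Boundary X) :=
  {p | ∃ x₀ : X, ∃ u : ℕ → U, SeqConvTo x₀ (fun n => ((u n : G)) • x₀) p}

/-- The small displacement set `E(U)` (relative to `δ`). -/
def smallDispSet (X : Type*) [MetricSpace X] [MulAction G X] (δ : ℝ) (U : Subgroup G) :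
    Set X :=
  {x | ∃ u : G, u ∈ U ∧ u ≠ 1 ∧ dist x (u • x) ≤ 100 * δ}

/-- `Z(U) = Conv(Λ(U) ∪ E(U))`. -/
def ZSet (X : Type*) [MetricSpace X] [MulAction G X] (δ : ℝ) (U : Subgroup G) : Set X :=
  geoConv (Sum.inr '' limitSet X U ∪ Sum.inl '' smallDispSet X δ U)

/-- The convex hull `X(U)`: the closure of `Conv(Z(U))`. -/
def cHull (X : Type*) [MetricSpace X] [MulAction G X] (δ : ℝ) (U : Subgroup G) : Set X :=
  closure (geoConv (Sum.inl '' ZSet X δ U))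

/-- The weak convex hull `X_U = Conv(Λ(U))`. -/
def weakHull (X : Type*) [MetricSpace X] [MulAction G X] (U : Subgroup G) : Set X :=
  geoConv (Sum.inr '' limitSet X U)

/-- `l_V(g) = d(X(V), gX(V))`. -/
def lV (X : Type*) [MetricSpace X] [MulAction G X] (δ : ℝ) (V : Subgroup G) (g : G) : ℝ :=
  setDist (cHull X δ V) (g • cHull X δ V)

/-- The translation length of `g`. -/
def translationLength (X : Type*) [MetricSpace X] [MulAction G X] (g : G) : ℝ :=
  sInf (Set.range fun x : X => dist x (g • x))

/-- The asymptotic translation length of `g`. -/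
def asympTranslationLength (X : Type*) [MetricSpace X] [MulAction G X] (g : G) : ℝ :=
  Filter.liminf (fun n : ℕ => translationLength X (g ^ n) / (n : ℝ)) Filter.atTop

/-- An elementary move between `G`-tuples `(U₁,…,U_n; h₁,…,h_m)`. -/
def gMove {n m : ℕ} (M M' : (Fin n → Subgroup G) × (Fin m → G)) : Prop :=
  (M'.2 = M.2 ∧ ∃ (j : Fin n) (g : G),
      g ∈ Subgroup.closure (Set.range M.2 ∪ ⋃ i ∈ {i : Fin n | i ≠ j}, ((M.1 i : Set G))) ∧
      (∀ i, i ≠ j → M'.1 i = M.1 i) ∧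
      M'.1 j = Subgroup.map (MulAut.conj g).toMonoidHom (M.1 j)) ∨
  (M'.1 = M.1 ∧ ∃ (i : Fin m) (g₁ g₂ : G),
      g₁ ∈ Subgroup.closure (M.2 '' {j : Fin m | j ≠ i} ∪ ⋃ t, ((M.1 t : Set G))) ∧
      g₂ ∈ Subgroup.closure (M.2 '' {j : Fin m | j ≠ i} ∪ ⋃ t, ((M.1 t : Set G))) ∧
      (∀ j, j ≠ i → M'.2 j = M.2 j) ∧
      M'.2 i = g₁ * M.2 i * g₂)

/-- Equivalence of `G`-tuples: a finite chain of elementary moves. -/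
def gEquiv {n m : ℕ} :
    (Fin n → Subgroup G) × (Fin m → G) → (Fin n → Subgroup G) × (Fin m → G) → Prop :=
  Relation.ReflTransGen gMove

/-- The family of factors `U₁,…,U_n, F(h₁),…,F(h_m)`. -/
def FF {n : ℕ} (m : ℕ) (U : Fin n → Subgroup G) : Fin n ⊕ Fin m → Type _
  | Sum.inl j => ↥(U j)
  | Sum.inr _ => FreeGroup PUnit

instance ffGroup {n : ℕ} (m : ℕ) (U : Fin n → Subgroup G) :
    (i : Fin n ⊕ Fin m) → Group (FF m U i)
  | Sum.inl j => inferInstanceAs (Group ↥(U j))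
  | Sum.inr _ => inferInstanceAs (Group (FreeGroup PUnit))

def ffHoms {n m : ℕ} (U : Fin n → Subgroup G) (H : Fin m → G) :
    (i : Fin n ⊕ Fin m) → FF m U i →* G
  | Sum.inl j => (U j).subtype
  | Sum.inr j => FreeGroup.lift fun _ => H j

/-- The canonical homomorphism `U₁ ∗ ⋯ ∗ U_n ∗ F(H) → G`. -/
def freeProdHom {n m : ℕ} (U : Fin n → Subgroup G) (H : Fin m → G) :
    Monoid.CoprodI (FF m U) →* G :=
  Monoid.CoprodI.lift (ffHoms U H)

/-- `W = U₁ ∗ ⋯ ∗ U_n ∗ F(H)`: the canonical homomorphism is injective with image `W`. -/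
def IsFreeProdDecomp {n m : ℕ} (U : Fin n → Subgroup G) (H : Fin m → G)
    (W : Subgroup G) : Prop :=
  Function.Injective (freeProdHom U H) ∧ (freeProdHom U H).range = W

/-- Minimality of the `G`-pair `(V; H)` (relative to a `1`-hyperbolic `G`-space `X`). -/
def PairMinimal (X : Type*) [MetricSpace X] [MulAction G X] {m : ℕ}
    (V : Subgroup G) (H : Fin m → G) : Prop :=
  ∀ (V' : Subgroup G) (H' : Fin m → G),
    gEquiv ((fun _ : Fin 1 => V), H) ((fun _ : Fin 1 => V'), H') →
    (∑ i, lV X 1 V (H i)) ≤ (∑ i, lV X 1 V' (H' i)) + 1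

/-- An elementary Nielsen move on tuples of elements of `G`. -/
def NielsenMove {k : ℕ} (g g' : Fin k → G) : Prop :=
  (∃ i : Fin k, (∀ j, j ≠ i → g' j = g j) ∧ g' i = (g i)⁻¹) ∨
  (∃ i j : Fin k, i ≠ j ∧ (∀ t, t ≠ i → g' t = g t) ∧ g' i = g i * g j) ∨
  (∃ i j : Fin k, i ≠ j ∧ g' = g ∘ Equiv.swap i j)

/-- Nielsen equivalence: a finite chain of elementary Nielsen moves. -/
def NielsenEq {k : ℕ} : (Fin k → G) → (Fin k → G) → Prop :=
  Relation.ReflTransGen NielsenMove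

/-- Word length of `g` with respect to the (symmetrized) generating set `S`. -/
def wordLength (S : Set G) (g : G) : ℕ :=
  sInf {n : ℕ | ∃ f : Fin n → G, (∀ i, f i ∈ S ∨ (f i)⁻¹ ∈ S) ∧ (List.ofFn f).prod = g}

/-- `(X, ι)` is a model of the Cayley graph `Γ(G,S)`. -/
def IsCayleyGraph (G : Type*) [Group G] (S : Set G) (X : Type*) [MetricSpace X]
    [MulAction G X] (ι : G → X) : Prop :=
  IsometricAction G X ∧
  (∀ g h : G, ι (g * h) = g • ι h) ∧
  Function.Injective ι ∧
  GeodesicSpace X ∧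
  (∀ g h : G, dist (ι g) (ι h) = (wordLength S (g⁻¹ * h) : ℝ)) ∧
  ∀ x : X, ∃ g h : G, wordLength S (g⁻¹ * h) ≤ 1 ∧
    ∃ s : Set X, IsGeodesicSegment s (ι g) (ι h) ∧ x ∈ s

/-- `H` is a quasiconvex subgroup (with respect to the Cayley graph model `(X, ι)`). -/
def QCSubgroup (X : Type*) [MetricSpace X] (ι : G → X) (H : Subgroup G) : Prop :=
  ∃ ε : ℝ, 0 ≤ ε ∧ Quasiconvex ε (ι '' (H : Set G))

end GroupAction

/-- Every nontrivial element of finite order has finite centralizer. -/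
def AlmostTorsionFree (G : Type*) [Group G] : Prop :=
  ∀ g : G, g ≠ 1 → IsOfFinOrder g → ((Subgroup.centralizer {g} : Subgroup G) : Set G).Finite

/-- `U` is nontrivial and admits no nontrivial free product decomposition. -/
def FreelyIndecomposable (U : Type*) [Group U] : Prop :=
  Nontrivial U ∧
    ¬ ∃ A B : Subgroup U, A ≠ ⊥ ∧ B ≠ ⊥ ∧
        Function.Bijective (Monoid.Coprod.lift A.subtype B.subtype)

def InfiniteCyclic (U : Type*) [Group U] : Prop := Infinite U ∧ IsCyclic U

def VirtuallyCyclic (U : Type*) [Group U] : Prop :=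
  ∃ H : Subgroup U, H.index ≠ 0 ∧ IsCyclic ↥H

def NonElementary (U : Type*) [Group U] : Prop := ¬ Finite U ∧ ¬ VirtuallyCyclic U

end KW

universe u v

namespace KW

open Pointwise Metric Set

section Helpers

variable {X : Type*} [MetricSpace X]

theorem seg_mem {s : Set X} {y z p : X} (h : IsGeodesicSegment s y z) (hp : p ∈ s) :
    dist y p + dist p z = dist y z := by
  obtain ⟨b, f, hb, h0, h1, hf, rfl⟩ := h
  obtain ⟨t, ht, rfl⟩ := hp
  have z0 : (0 : ℝ) ∈ Set.Icc 0 b := ⟨le_rfl, hb⟩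
  have zb : b ∈ Set.Icc 0 b := ⟨hb, le_rfl⟩
  rw [← h0, ← h1, hf _ z0 _ ht, hf _ ht _ zb, hf _ z0 _ zb]
  rw [abs_of_nonpos (by linarith [ht.1]), abs_of_nonpos (by linarith [ht.2]),
    abs_of_nonpos (by linarith)]
  ring

theorem gromov_le_of_mem {s : Set X} {y z p : X} (h : IsGeodesicSegment s y z) (hp : p ∈ s)
    (x : X) : gromov x y z ≤ dist x p := by
  have h1 := seg_mem h hp
  have h2 := dist_triangle y p x
  have h3 := dist_triangle z p x
  rw [dist_comm p x] at h2 h3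
  rw [dist_comm z p] at h3
  unfold gromov
  linarith

theorem gromov_comm (x y z : X) : gromov x y z = gromov x z y := by
  unfold gromov
  rw [dist_comm y z]; ring

theorem seg_contOn {b : ℝ} {f : ℝ → X}
    (hf : ∀ u ∈ Set.Icc (0 : ℝ) b, ∀ v ∈ Set.Icc (0 : ℝ) b, dist (f u) (f v) = |u - v|) :
    ContinuousOn f (Set.Icc 0 b) := by
  rw [Metric.continuousOn_iff]
  intro u hu ε hε
  refine ⟨ε, hε, fun v hv hd => ?_⟩
  rw [hf v hv u hu]
  rwa [Real.dist_eq] at hd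

theorem seg_compact {s : Set X} {y z : X} (h : IsGeodesicSegment s y z) : IsCompact s := by
  obtain ⟨b, f, hb, h0, h1, hf, rfl⟩ := h
  exact isCompact_Icc.image_of_continuousOn (seg_contOn hf)

theorem seg_left {s : Set X} {y z : X} (h : IsGeodesicSegment s y z) : y ∈ s := by
  obtain ⟨b, f, hb, h0, h1, hf, rfl⟩ := h
  exact ⟨0, ⟨le_rfl, hb⟩, h0⟩

theorem seg_right {s : Set X} {y z : X} (h : IsGeodesicSegment s y z) : z ∈ s := by
  obtain ⟨b, f, hb, h0, h1, hf, rfl⟩ := h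
  exact ⟨b, ⟨hb, le_rfl⟩, h1⟩

theorem rips_point {δ : ℝ} (hδ : 0 < δ) (hh : DeltaHyperbolic δ X) {s : Set X} {y z : X}
    (h : IsGeodesicSegment s y z) (x : X) : ∃ p ∈ s, dist x p ≤ gromov x y z + 2 * δ := by
  obtain ⟨s₂, hs₂⟩ := hh.1 z x
  obtain ⟨s₃, hs₃⟩ := hh.1 y x
  have thin := hh.2 y z x s s₂ s₃ h hs₂ hs₃
  have hseg := h
  obtain ⟨b, f, hb, h0, h1, hf, rfl⟩ := h
  have hc := seg_contOn hf
  have closedT : ∀ S : Set X, IsClosed {t | t ∈ Set.Icc 0 b ∧ infDist (f t) S ≤ δ} := by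
    intro S
    have hc2 : ContinuousOn (fun t => infDist (f t) S) (Set.Icc 0 b) :=
      (continuous_infDist_pt S).comp_continuousOn hc
    exact hc2.preimage_isClosed_of_isClosed isClosed_Icc (isClosed_Iic (a := δ))
  have key := isPreconnected_closed_iff.1 (isPreconnected_Icc (a := (0 : ℝ)) (b := b))
    _ _ (closedT s₂) (closedT s₃) ?_ ?_ ?_
  · obtain ⟨t, ht, ⟨-, ht2⟩, ⟨-, ht3⟩⟩ := key
    have hp : f t ∈ f '' Set.Icc 0 b := ⟨t, ht, rfl⟩
    refine ⟨f t, hp, ?_⟩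
    obtain ⟨q, hq, hqd⟩ := (seg_compact hs₂).exists_infDist_eq_dist ⟨_, seg_left hs₂⟩ (f t)
    obtain ⟨r, hr, hrd⟩ := (seg_compact hs₃).exists_infDist_eq_dist ⟨_, seg_left hs₃⟩ (f t)
    rw [hqd] at ht2
    rw [hrd] at ht3
    have e1 := seg_mem hs₂ hq
    have e2 := seg_mem hs₃ hr
    have e3 := seg_mem hseg hp
    have t1 := dist_triangle x q (f t)
    have t2 := dist_triangle z q (f t)
    have t3 := dist_triangle x r (f t)
    have t4 := dist_triangle y r (f t)
    rw [dist_comm q (f t)] at t1 t2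
    rw [dist_comm r (f t)] at t3 t4
    rw [dist_comm x q] at t1
    rw [dist_comm x r] at t3
    rw [dist_comm z (f t)] at t2
    unfold gromov
    linarith
  · intro t ht
    obtain ⟨q, hq, hd⟩ := thin (f t) ⟨t, ht, rfl⟩
    rcases hq with hq | hq
    · exact Or.inl ⟨ht, (infDist_le_dist_of_mem hq).trans hd⟩
    · exact Or.inr ⟨ht, (infDist_le_dist_of_mem hq).trans hd⟩
  · refine ⟨b, ⟨hb, le_rfl⟩, ⟨hb, le_rfl⟩, ?_⟩
    rw [h1, infDist_zero_of_mem (seg_left hs₂)]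
    exact hδ.le
  · refine ⟨0, ⟨le_rfl, hb⟩, ⟨le_rfl, hb⟩, ?_⟩
    rw [h0, infDist_zero_of_mem (seg_left hs₃)]
    exact hδ.le

theorem gromov_ineq {δ : ℝ} (hδ : 0 < δ) (hh : DeltaHyperbolic δ X) (w x y z : X) {M : ℝ}
    (h1 : M ≤ gromov w x y) (h2 : M ≤ gromov w y z) : M - 3 * δ ≤ gromov w x z := by
  obtain ⟨s, hs⟩ := hh.1 x z
  obtain ⟨s₂, hs₂⟩ := hh.1 z y
  obtain ⟨s₃, hs₃⟩ := hh.1 x y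
  obtain ⟨p, hp, hpd⟩ := rips_point hδ hh hs w
  obtain ⟨q, hq, hqd⟩ := hh.2 x z y s s₂ s₃ hs hs₂ hs₃ p hp
  have t := dist_triangle w p q
  rcases hq with hq | hq
  · have := gromov_le_of_mem hs₂ hq w
    rw [gromov_comm] at this
    linarith
  · have := gromov_le_of_mem hs₃ hq w
    linarith

/-- Four point inequality. -/
theorem four_point {δ : ℝ} (hδ : 0 < δ) (hh : DeltaHyperbolic δ X) (w x y z : X) {B : ℝ}
    (h1 : dist x y + dist z w ≤ B) (h2 : dist y z + dist x w ≤ B) :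
    dist x z + dist y w ≤ B + 6 * δ := by
  have := gromov_ineq hδ hh w x y z
    (M := (dist x w + dist y w + dist z w - B) / 2)
    (by unfold gromov; linarith) (by unfold gromov; linarith)
  unfold gromov at this
  linarith

/-- Orbit growth. -/
theorem orbit_growth {δ : ℝ} (hδ : 0 < δ) (hh : DeltaHyperbolic δ X) (P : ℤ → X)
    (hP : ∀ i j k : ℤ, dist (P (i + k)) (P (j + k)) = dist (P i) (P j))
    (h2 : dist (P 0) (P 1) + 10 * δ ≤ dist (P 0) (P 2)) (n : ℕ) :
    dist (P 0) (P n) + 4 * δ ≤ dist (P 0) (P (n + 1)) := by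
  induction n with
  | zero =>
    have e := hP 0 1 1
    have t := dist_triangle (P 0) (P 1) (P 2)
    norm_num at e ⊢
    linarith
  | succ k ih =>
    by_contra hcon
    push Not at hcon
    push_cast at hcon ih
    have e1 : dist (P 1) (P (k + 1 + 1)) = dist (P 0) (P (k + 1)) := by
      have := hP 0 (k + 1) 1
      simpa using this
    have e2 : dist (P 2) (P (k + 1 + 1)) = dist (P 0) (P k) := by
      have := hP 0 k 2
      rw [show (k : ℤ) + 1 + 1 = k + 2 by ring]
      simpa using this
    have e3 : dist (P 1) (P 2) = dist (P 0) (P 1) := by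
      have := hP 0 1 1
      simpa using this
    have := four_point hδ hh (P (k + 1 + 1)) (P 0) (P 1) (P 2)
      (B := dist (P 0) (P 1) + max (dist (P 0) (P k)) (dist (P 0) (P (k + 1 + 1))))
      (by rw [e2]; linarith [le_max_left (dist (P 0) (P k)) (dist (P 0) (P (k + 1 + 1)))])
      (by rw [e3]; linarith [le_max_right (dist (P 0) (P k)) (dist (P 0) (P (k + 1 + 1)))])
    rw [e1] at this
    rcases max_cases (dist (P 0) (P k)) (dist (P 0) (P (k + 1 + 1))) with h | h
    · linarith [h.1]
    · linarith [h.1]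

theorem orbit_growth' {δ : ℝ} (hδ : 0 < δ) (hh : DeltaHyperbolic δ X) (P : ℤ → X)
    (hP : ∀ i j k : ℤ, dist (P (i + k)) (P (j + k)) = dist (P i) (P j))
    (h2 : dist (P 0) (P 1) + 10 * δ ≤ dist (P 0) (P 2)) (n k : ℕ) :
    dist (P 0) (P n) + 4 * δ * k ≤ dist (P 0) (P (n + k)) := by
  induction k with
  | zero => simp
  | succ k ih =>
    have := orbit_growth hδ hh P hP h2 (n + k)
    push_cast at this ⊢
    rw [← add_assoc]
    linarith

theorem orbit_gromov {δ : ℝ} (hδ : 0 < δ) (hh : DeltaHyperbolic δ X) (P : ℤ → X)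
    (hP : ∀ i j k : ℤ, dist (P (i + k)) (P (j + k)) = dist (P i) (P j))
    (h2 : dist (P 0) (P 1) + 10 * δ ≤ dist (P 0) (P 2)) (n k : ℕ) :
    dist (P 0) (P n) / 2 + 2 * δ * n ≤ gromov (P 0) (P n) (P (n + k : ℕ)) := by
  have h := orbit_growth' hδ hh P hP h2 k n
  have e : dist (P n) (P (n + k : ℕ)) = dist (P 0) (P k) := by
    have := hP 0 k n
    rw [zero_add] at this
    push_cast
    rw [add_comm (n : ℤ) k]
    exact this
  unfold gromov
  rw [e, dist_comm (P n) (P 0), dist_comm (P (n + k : ℕ)) (P 0)]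
  push_cast
  rw [add_comm (n : ℤ) k]
  linarith

theorem orbit_cauchy {δ : ℝ} (hδ : 0 < δ) (hh : DeltaHyperbolic δ X) (P : ℤ → X)
    (hP : ∀ i j k : ℤ, dist (P (i + k)) (P (j + k)) = dist (P i) (P j))
    (h2 : dist (P 0) (P 1) + 10 * δ ≤ dist (P 0) (P 2)) (M : ℝ) :
    ∃ N : ℕ, ∀ n, N ≤ n → ∀ m, N ≤ m → M ≤ gromov (P 0) (P (n : ℕ)) (P (m : ℕ)) := by
  obtain ⟨N, hN⟩ := exists_nat_ge (M / (2 * δ))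
  have hN' : M ≤ 2 * δ * N := by
    rw [div_le_iff₀ (by linarith)] at hN
    linarith
  have main : ∀ n k : ℕ, N ≤ n → M ≤ gromov (P 0) (P (n : ℕ)) (P (n + k : ℕ)) := by
    intro n k hn
    have h := orbit_gromov hδ hh P hP h2 n k
    have h3 : (N : ℝ) ≤ n := by exact_mod_cast hn
    have h4 : 2 * δ * (N : ℝ) ≤ 2 * δ * n := by
      apply mul_le_mul_of_nonneg_left h3; linarith
    have := dist_nonneg (x := P 0) (y := P n)
    linarith
  refine ⟨N, fun n hn m hm => ?_⟩
  rcases le_total n m with h | h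
  · obtain ⟨k, rfl⟩ := Nat.exists_eq_add_of_le h
    exact main n k hn
  · obtain ⟨k, rfl⟩ := Nat.exists_eq_add_of_le h
    rw [gromov_comm]
    exact main m k hm

theorem orbit_mid {δ : ℝ} (hδ : 0 < δ) (hh : DeltaHyperbolic δ X) (P : ℤ → X)
    (hP : ∀ i j k : ℤ, dist (P (i + k)) (P (j + k)) = dist (P i) (P j))
    (h2 : dist (P 0) (P 1) + 10 * δ ≤ dist (P 0) (P 2)) (n : ℕ) (hn : 1 ≤ n) :
    gromov (P 0) (P (-(n : ℤ))) (P n) ≤ dist (P 0) (P 1) / 2 + δ := by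
  by_contra hcon
  push Not at hcon
  obtain ⟨k, rfl⟩ := Nat.exists_eq_add_of_le hn
  have hn1 : dist (P 0) (P (-1)) = dist (P 0) (P 1) := by
    have := hP 0 (-1) 1
    norm_num at this
    rw [← this, dist_comm]
  have hn2 : dist (P 0) (P (-2)) = dist (P 0) (P 2) := by
    have := hP 0 (-2) 2
    norm_num at this
    rw [← this, dist_comm]
  have o1 := orbit_gromov hδ hh P hP h2 1 k
  have o2 := orbit_gromov hδ hh (fun i => P (-i))
    (by intro i j k; simpa [neg_add, add_comm] using hP (-i) (-j) (-k))
    (by simpa [hn1, hn2] using h2) 1 k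
  simp only [neg_zero, Nat.cast_one, mul_one, hn1] at o1 o2
  set A := P (-((1 + k : ℕ) : ℤ))
  set B := P ((1 + k : ℕ) : ℤ)
  set M := min (gromov (P 0) A B) (dist (P 0) (P 1) / 2 + 2 * δ) with hM
  have hMlt : dist (P 0) (P 1) / 2 + δ < M := lt_min hcon (by linarith)
  have g1 := gromov_ineq hδ hh (P 0) (P (-1)) A B (M := M) ((min_le_right _ _).trans o2)
    (min_le_left _ _)
  have g2 := gromov_ineq hδ hh (P 0) (P (-1)) B (P 1) (M := M - 3 * δ) g1
    (by rw [gromov_comm]; linarith [min_le_right (gromov (P 0) A B) (dist (P 0) (P 1) / 2 + 2 * δ)])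
  have e : dist (P (-1)) (P 1) = dist (P 0) (P 2) := by
    have := hP (-1) 1 1
    norm_num at this
    exact this.symm
  unfold gromov at g2
  rw [e, dist_comm (P (-1)), dist_comm (P 1), hn1] at g2
  linarith

/-- Convergence of the end of a path and a sequence to the same boundary point. -/
def TendsG (x : X) (σ : ℝ → X) (u : ℕ → X) : Prop :=
  ∀ M : ℝ, ∃ N : ℕ, ∀ t : ℝ, (N : ℝ) ≤ t → ∀ m, N ≤ m → M ≤ gromov x (σ t) (u m)

def FreqClose (K : ℝ) (σ τ : ℝ → X) : Prop :=
  ∀ T : ℝ, ∃ t, T ≤ t ∧ ∃ s, 0 ≤ s ∧ dist (σ t) (τ s) ≤ K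

theorem end_conv {δ : ℝ} (hδ : 0 < δ) (hh : DeltaHyperbolic δ X) {x : X} {σ τ : ℝ → X}
    {u : ℕ → X} (hσ : IsGeodesicRay σ) (hτ : IsGeodesicRay τ) (hx : τ 0 = x)
    (hu : ∀ M : ℝ, ∃ N : ℕ, ∀ n, N ≤ n → ∀ m, N ≤ m → M ≤ gromov x (τ (n : ℝ)) (u m))
    {K : ℝ} (hK : FreqClose K σ τ) : TendsG x σ u := by
  intro M
  obtain ⟨N0, hN0⟩ := hu (M + 9 * δ)
  set D := dist x (σ 0) with hD
  have hD0 : 0 ≤ D := dist_nonneg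
  obtain ⟨N1, hN1⟩ := exists_nat_ge (max 0 (M + 9 * δ + D))
  have hN1' := (le_max_right _ _).trans hN1
  refine ⟨max N0 N1, fun t ht m hm => ?_⟩
  set n := max N0 N1 with hn
  have hn1 : (N1 : ℝ) ≤ n := by exact_mod_cast le_max_right N0 N1
  have hn0 : (0 : ℝ) ≤ n := Nat.cast_nonneg n
  obtain ⟨t', ht', s', hs', hd⟩ := hK (max t (M + 9 * δ + D + K))
  have ht1 := (le_max_left _ _).trans ht'
  have ht2 := (le_max_right _ _).trans ht'
  have dσ : ∀ r, 0 ≤ r → r - D ≤ dist (σ r) x := by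
    intro r hr
    have h1 := hσ r 0 hr le_rfl
    rw [sub_zero, abs_of_nonneg hr] at h1
    have := dist_triangle (σ r) x (σ 0)
    linarith
  have dτ : ∀ r, 0 ≤ r → dist (τ r) x = r := by
    intro r hr
    rw [← hx, hτ r 0 hr le_rfl, sub_zero, abs_of_nonneg hr]
  have a1 : M + 9 * δ ≤ gromov x (σ t) (σ t') := by
    have h1 := dσ t (by linarith)
    have h2 := dσ t' (by linarith)
    have h3 := hσ t t' (by linarith) (by linarith)
    rw [abs_of_nonpos (by linarith)] at h3
    unfold gromov
    linarith
  have tri := dist_triangle (σ t') (τ s') x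
  have h2 := dσ t' (by linarith)
  have h4 := dτ s' hs'
  have a2 : M + 9 * δ ≤ gromov x (σ t') (τ s') := by
    unfold gromov
    linarith
  have a3 : M + 9 * δ ≤ gromov x (τ s') (τ n) := by
    have h5 := dτ n hn0
    have h3 := hτ s' n hs' hn0
    unfold gromov
    rw [h3, h4, h5]
    rcases abs_cases (s' - (n : ℝ)) with h | h <;> linarith [h.1]
  have a4 := hN0 n (le_max_left _ _) m ((le_max_left _ _).trans hm)
  have b1 := gromov_ineq hδ hh x _ _ _ a1 a2
  have b2 := gromov_ineq hδ hh x _ _ _ b1 (by linarith : _ ≤ gromov x (τ s') (τ n))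
  have b3 := gromov_ineq hδ hh x _ _ _ b2 (by linarith : _ ≤ gromov x (τ n) (u m))
  linarith

theorem bi_seg {γ : ℝ → X} (hγ : IsBiGeodesic γ) {T : ℝ} (hT : 0 ≤ T) :
    IsGeodesicSegment (γ '' Set.Icc (-T) T) (γ (-T)) (γ T) := by
  refine ⟨2 * T, fun t => γ (t - T), by linarith, by simp, by ring_nf, ?_, ?_⟩
  · intro a _ b _
    show dist (γ (a - T)) (γ (b - T)) = _
    rw [hγ]
    congr 1
    ring
  · ext p
    constructor
    · rintro ⟨t, ht, rfl⟩
      exact ⟨t + T, ⟨by linarith [ht.1], by linarith [ht.2]⟩, by simp⟩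
    · rintro ⟨t, ht, rfl⟩
      exact ⟨t - T, ⟨by linarith [ht.1], by linarith [ht.2]⟩, rfl⟩

theorem near_point {δ : ℝ} (hδ : 0 < δ) (hh : DeltaHyperbolic δ X) {x : X} {γ : ℝ → X}
    {u v : ℕ → X} (hγ : IsBiGeodesic γ) (hu : TendsG x γ u)
    (hv : TendsG x (fun t => γ (-t)) v) {B : ℝ}
    (hB : ∀ n, 1 ≤ n → gromov x (v n) (u n) ≤ B) : ∃ z ∈ Set.range γ, dist x z ≤ B + 8 * δ := by
  obtain ⟨N1, h1⟩ := hu (B + 7 * δ)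
  obtain ⟨N2, h2⟩ := hv (B + 7 * δ)
  set n := max 1 (max N1 N2) with hn
  have hn1 : N1 ≤ n := (le_max_left _ _).trans (le_max_right _ _)
  have hn2 : N2 ≤ n := (le_max_right _ _).trans (le_max_right _ _)
  have c1 := h1 n (by exact_mod_cast hn1) n hn1
  have c2 := h2 n (by exact_mod_cast hn2) n hn2
  have c3 := hB n (le_max_left _ _)
  have key : gromov x (γ (-(n : ℝ))) (γ n) ≤ B + 6 * δ := by
    by_contra hcon
    push Not at hcon
    set M := min (gromov x (γ (-(n : ℝ))) (γ n)) (B + 7 * δ) with hM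
    have hMlt : B + 6 * δ < M := lt_min hcon (by linarith)
    have hM2 : M ≤ B + 7 * δ := min_le_right _ _
    have g1 := gromov_ineq hδ hh x (v n) (γ (-(n : ℝ))) (γ n) (M := M)
      (by rw [gromov_comm]; exact hM2.trans c2) (min_le_left _ _)
    have g2 := gromov_ineq hδ hh x (v n) (γ n) (u n) g1 (by linarith)
    linarith
  obtain ⟨p, hp, hd⟩ := rips_point hδ hh (bi_seg hγ (Nat.cast_nonneg n)) x
  obtain ⟨t, -, rfl⟩ := hp
  exact ⟨_, ⟨t, rfl⟩, by linarith⟩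

theorem bi_ray {γ : ℝ → X} (hγ : IsBiGeodesic γ) : IsGeodesicRay γ := fun s t _ _ => hγ s t

theorem bi_neg {γ : ℝ → X} (hγ : IsBiGeodesic γ) : IsBiGeodesic (fun t => γ (-t)) := by
  intro s t
  show dist (γ (-s)) (γ (-t)) = _
  rw [hγ, ← abs_neg]
  congr 1
  ring

theorem ray_conv {γ : ℝ → X} (hγ : IsGeodesicRay γ) :
    SeqConvTo (γ 0) (fun n => γ (n : ℝ)) (Boundary.mk ⟨γ, hγ⟩) := by
  refine ⟨⟨γ, hγ⟩, rfl, fun M => ?_⟩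
  obtain ⟨N, hN⟩ := exists_nat_ge M
  refine ⟨N, fun n hn m hm => ?_⟩
  have hn' : (N : ℝ) ≤ n := by exact_mod_cast hn
  have hm' : (N : ℝ) ≤ m := by exact_mod_cast hm
  have n0 : (0 : ℝ) ≤ n := Nat.cast_nonneg n
  have m0 : (0 : ℝ) ≤ m := Nat.cast_nonneg m
  unfold gromov
  show M ≤ (dist (γ n) (γ 0) + dist (γ m) (γ 0) - dist (γ n) (γ m)) / 2
  rw [hγ _ _ n0 le_rfl, hγ _ _ m0 le_rfl, hγ _ _ n0 m0, sub_zero, sub_zero,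
    abs_of_nonneg n0, abs_of_nonneg m0]
  rcases abs_cases ((n : ℝ) - m) with h | h <;> linarith [h.1]

theorem ends_ne {γ : ℝ → X} (hγ : IsBiGeodesic γ) :
    Boundary.mk ⟨fun t => γ (-t), bi_ray (bi_neg hγ)⟩ ≠ Boundary.mk ⟨γ, bi_ray hγ⟩ := by
  intro h
  have h' : Asymptotic (fun t => γ (-t)) γ := Quotient.exact h
  obtain ⟨K, hK, -⟩ := h'
  have hpos : 0 ≤ |K| + 1 := by positivity
  obtain ⟨b, ⟨s, hs, rfl⟩, hd⟩ := hK _ ⟨|K| + 1, hpos, rfl⟩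
  have hs' : 0 ≤ s := hs
  change dist (γ (-(|K| + 1))) (γ s) ≤ K at hd
  rw [hγ, abs_of_nonpos (by linarith)] at hd
  linarith [le_abs_self K]

theorem not_both {δ : ℝ} (hδ : 0 < δ) (hh : DeltaHyperbolic δ X) {x : X} {γ : ℝ → X}
    {u : ℕ → X} (hγ : IsBiGeodesic γ) (h1 : TendsG x γ u)
    (h2 : TendsG x (fun t => γ (-t)) u) : False := by
  obtain ⟨N1, h1⟩ := h1 (dist x (γ 0) + 4 * δ)
  obtain ⟨N2, h2⟩ := h2 (dist x (γ 0) + 4 * δ)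
  set n := max N1 N2 with hn
  have hn1 : N1 ≤ n := le_max_left _ _
  have hn2 : N2 ≤ n := le_max_right _ _
  have c1 := h1 n (by exact_mod_cast hn1) n hn1
  have c2 := h2 n (by exact_mod_cast hn2) n hn2
  rw [gromov_comm] at c1
  have := gromov_ineq hδ hh x _ _ _ c2 c1
  have n0 : (0 : ℝ) ≤ n := Nat.cast_nonneg n
  have le := gromov_le_of_mem (bi_seg hγ n0) ⟨0, ⟨by linarith, n0⟩, rfl⟩ x
  linarith

/-- The ends of the biinfinite geodesic. -/
theorem ends_sorted {δ : ℝ} (hδ : 0 < δ) (hh : DeltaHyperbolic δ X) {x : X} {γ γ₁ γ₂ : ℝ → X}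
    {u v : ℕ → X} (hγ : IsBiGeodesic γ) (h₁ : IsGeodesicRay γ₁) (h₂ : IsGeodesicRay γ₂)
    (hx₁ : γ₁ 0 = x) (hx₂ : γ₂ 0 = x)
    (hu : ∀ M : ℝ, ∃ N : ℕ, ∀ n, N ≤ n → ∀ m, N ≤ m → M ≤ gromov x (γ₁ (n : ℝ)) (u m))
    (hv : ∀ M : ℝ, ∃ N : ℕ, ∀ n, N ≤ n → ∀ m, N ≤ m → M ≤ gromov x (γ₂ (n : ℝ)) (v m))
    (hcl : HausdorffClose (Set.range γ) (γ₁ '' Set.Ici 0 ∪ γ₂ '' Set.Ici 0)) :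
    ∃ γ' : ℝ → X, IsBiGeodesic γ' ∧ TendsG x γ' u ∧ TendsG x (fun t => γ' (-t)) v := by
  obtain ⟨K, hK, -⟩ := hcl
  have alt : ∀ σ : ℝ → X, (∀ t, σ t ∈ Set.range γ) → IsGeodesicRay σ →
      TendsG x σ u ∨ TendsG x σ v := by
    intro σ hσ hr
    by_cases hf : FreqClose K σ γ₁
    · exact Or.inl (end_conv hδ hh hr h₁ hx₁ hu hf)
    · right
      apply end_conv hδ hh hr h₂ hx₂ hv (K := K)
      unfold FreqClose at hf
      push Not at hf
      obtain ⟨T0, hT0⟩ := hf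
      intro T
      refine ⟨max T T0, le_max_left _ _, ?_⟩
      obtain ⟨b, hb, hd⟩ := hK _ (hσ (max T T0))
      rcases hb with ⟨s, hs, rfl⟩ | ⟨s, hs, rfl⟩
      · exact absurd hd (not_le.2 (hT0 _ (le_max_right _ _) s hs))
      · exact ⟨s, hs, hd⟩
  have A := alt γ (fun t => ⟨t, rfl⟩) (bi_ray hγ)
  have B := alt (fun t => γ (-t)) (fun t => ⟨-t, rfl⟩) (bi_ray (bi_neg hγ))
  rcases A with A | A <;> rcases B with B | B
  · exact (not_both hδ hh hγ A B).elim
  · exact ⟨γ, hγ, A, B⟩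
  · exact ⟨fun t => γ (-t), bi_neg hγ, B, by simpa using A⟩
  · exact (not_both hδ hh hγ A B).elim

theorem not_asymp {δ : ℝ} (hδ : 0 < δ) (hh : DeltaHyperbolic δ X) {x : X} {γ₁ γ₂ : ℝ → X}
    {u v : ℕ → X} (h₁ : IsGeodesicRay γ₁) (h₂ : IsGeodesicRay γ₂)
    (hx₁ : γ₁ 0 = x)
    (hu : ∀ M : ℝ, ∃ N : ℕ, ∀ n, N ≤ n → ∀ m, N ≤ m → M ≤ gromov x (γ₁ (n : ℝ)) (u m))
    (hv : ∀ M : ℝ, ∃ N : ℕ, ∀ n, N ≤ n → ∀ m, N ≤ m → M ≤ gromov x (γ₂ (n : ℝ)) (v m))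
    {B : ℝ} (hB : ∀ n, 1 ≤ n → gromov x (v n) (u n) ≤ B) : ¬ Asymptotic γ₁ γ₂ := by
  rintro ⟨K, -, hK⟩
  have hf : FreqClose K γ₂ γ₁ := by
    intro T
    obtain ⟨a, ⟨s, hs, rfl⟩, hd⟩ := hK (γ₂ (max T 0)) ⟨_, le_max_right T 0, rfl⟩
    exact ⟨max T 0, le_max_left _ _, s, hs, by rwa [dist_comm]⟩
  obtain ⟨N1, h1⟩ := end_conv hδ hh h₂ h₁ hx₁ hu hf (B + 4 * δ)
  obtain ⟨N2, h2⟩ := hv (B + 4 * δ)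
  set n := max 1 (max N1 N2) with hn
  have hn1 : N1 ≤ n := (le_max_left _ _).trans (le_max_right _ _)
  have hn2 : N2 ≤ n := (le_max_right _ _).trans (le_max_right _ _)
  have c1 := h1 n (by exact_mod_cast hn1) n hn1
  have c2 := h2 n hn2 n hn2
  rw [gromov_comm] at c2
  have := gromov_ineq hδ hh x _ _ _ c2 c1
  linarith [hB n (le_max_left _ _)]

theorem sq_le_two_pow' (j : ℕ) (hj : 4 ≤ j) : (j : ℝ) ^ 2 ≤ 2 ^ j := by
  have : j ^ 2 ≤ 2 ^ j := by
    induction j, hj using Nat.le_induction with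
    | base => norm_num
    | succ k hk ih => rw [pow_succ 2 k]; nlinarith
  exact_mod_cast this

theorem doubling {δ c : ℝ} (hδ : 0 < δ) (hc : 0 < c) (a : ℕ → ℝ)
    (ha : ∀ j : ℕ, 2 ^ j * c ≤ a (2 ^ j)) (h1 : a 1 ≤ 100 * δ) :
    ∃ j : ℕ, a (2 ^ j) + 10 * δ ≤ a (2 ^ j * 2) ∧ a (2 ^ j) ≤ 100 * δ + 10 * δ * j := by
  by_contra hcon
  push Not at hcon
  have bound : ∀ j : ℕ, a (2 ^ j) ≤ 100 * δ + 10 * δ * j := by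
    intro j
    induction j with
    | zero => simpa using h1
    | succ k ih =>
      by_contra hk
      have := hcon k
      rw [← pow_succ] at this
      by_cases h : a (2 ^ k) + 10 * δ ≤ a (2 ^ (k + 1))
      · linarith [this h]
      · push_cast at hk
        linarith
  obtain ⟨n, hn⟩ := exists_nat_ge (110 * δ / c)
  have hn' : 110 * δ ≤ n * c := by rwa [div_le_iff₀ hc] at hn
  have b := bound (n + 4)
  have e := ha (n + 4)
  have s := sq_le_two_pow' (n + 4) (by omega)
  have s' := mul_le_mul_of_nonneg_right s hc.le
  push_cast at b s'
  have n0 : (0 : ℝ) ≤ n := Nat.cast_nonneg n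
  nlinarith [mul_nonneg n0 hc.le, mul_nonneg n0 hδ.le,
    mul_le_mul_of_nonneg_left hn' n0]

theorem numeric {δ c A : ℝ} (hδ : 0 < δ) (hc : 0 < c) (hcu : c ≤ 100 * δ) (j : ℕ)
    (h1 : 2 ^ j * c ≤ A) (h2 : A ≤ 100 * δ + 10 * δ * j) :
    A / 2 + δ + 8 * δ ≤ 5000 * δ ^ 2 / c + 50 * δ := by
  have key : (9 + 5 * (j : ℝ)) * c ≤ 5000 * δ := by
    rcases lt_or_ge j 4 with hj | hj
    · have hj' : (j : ℝ) ≤ 4 := by exact_mod_cast hj.le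
      nlinarith
    · have s := mul_le_mul_of_nonneg_right (sq_le_two_pow' j hj) hc.le
      have hj' : (4 : ℝ) ≤ j := by exact_mod_cast hj
      have h3 : (j : ℝ) ^ 2 * c ≤ 100 * δ + 10 * δ * j := by linarith
      have h4 : (9 + 5 * (j : ℝ)) * (10 + j) ≤ 500 * (j : ℝ) ^ 2 := by nlinarith
      have h5 := mul_le_mul_of_nonneg_right h4 hc.le
      have h6 : (9 + 5 * (j : ℝ)) * c * (10 + j) ≤ 5000 * δ * (10 + j) := by nlinarith
      exact le_of_mul_le_mul_right h6 (by linarith)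
  have : (9 + 5 * (j : ℝ)) * δ ≤ 5000 * δ ^ 2 / c := by
    rw [le_div_iff₀ hc]
    nlinarith
  linarith

end Helpers

section Act

variable {G : Type*} {X : Type*} [Group G] [MetricSpace X] [MulAction G X]

theorem dist_pow_le (hiso : IsometricAction G X) (h : G) (y : X) (k : ℕ) :
    dist y (h ^ k • y) ≤ k * dist y (h • y) := by
  induction k with
  | zero => simp
  | succ k ih =>
    have t := dist_triangle y (h ^ k • y) (h ^ (k + 1) • y)
    have e : dist (h ^ k • y) (h ^ (k + 1) • y) = dist y (h • y) := by
      rw [pow_succ, mul_smul, hiso]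
    push_cast
    linarith

theorem asymp_le (hiso : IsometricAction G X) (g : G) {c : ℝ}
    (hlen : asympTranslationLength X g = c) (y : X) (N : ℕ) (hN : 1 ≤ N) :
    N * c ≤ dist y (g ^ N • y) := by
  have hbdd : ∀ f : G, BddBelow (Set.range fun x : X => dist x (f • x)) := fun f =>
    ⟨0, by rintro _ ⟨x, rfl⟩; exact dist_nonneg⟩
  have hN' : (0 : ℝ) < N := by exact_mod_cast hN
  have : c ≤ dist y (g ^ N • y) / N := by
    rw [← hlen]
    unfold asympTranslationLength
    apply Filter.liminf_le_of_frequently_le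
    · rw [Filter.frequently_atTop]
      intro a
      refine ⟨N * (a + 1), by nlinarith, ?_⟩
      have h1 : translationLength X (g ^ (N * (a + 1))) ≤ dist y (g ^ (N * (a + 1)) • y) :=
        csInf_le (hbdd _) ⟨y, rfl⟩
      have h2 := dist_pow_le hiso (g ^ N) y (a + 1)
      rw [← pow_mul] at h2
      have h3 : (0 : ℝ) < ((a + 1 : ℕ) : ℝ) := by positivity
      rw [div_le_div_iff₀ (by push_cast; push_cast at h3; positivity) hN']
      rw [Nat.cast_mul]
      nlinarith
    · refine Filter.isBoundedUnder_of ⟨0, fun n => ?_⟩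
      apply div_nonneg _ (Nat.cast_nonneg n)
      apply Real.sInf_nonneg
      rintro _ ⟨x, rfl⟩
      exact dist_nonneg
  rw [le_div_iff₀ hN'] at this
  linarith

theorem mem_limit {x : X} {σ : ℝ → X} (hσ : IsGeodesicRay σ) (U : Subgroup G) (u : ℕ → U)
    (h : TendsG x σ (fun n => (u n : G) • x)) : Boundary.mk ⟨σ, hσ⟩ ∈ limitSet X U := by
  refine ⟨x, u, ⟨σ, hσ⟩, rfl, fun M => ?_⟩
  obtain ⟨N, hN⟩ := h M
  refine ⟨N, fun n hn m hm => ?_⟩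
  rw [gromov_comm]
  exact hN m (by exact_mod_cast hm) n hn

end Act

theorem statement11 {G : Type u} {X : Type v} [Group G] [MetricSpace X] [MulAction G X]
    (δ : ℝ) (hδ : 0 < δ) (hiso : IsometricAction G X) (hsg : StronglyGeodesic X)
    (hhyp : DeltaHyperbolic δ X) (g : G) (c : ℝ) (hc : 0 < c)
    (hlen : asympTranslationLength X g = c) :
    ∀ x : X, dist x (g • x) ≤ 100 * δ →
      ∃ z ∈ weakHull X (Subgroup.zpowers g), dist x z ≤ 5000 * δ ^ 2 / c + 50 * δ := by
  intro x hx
  have hlow := fun N hN => asymp_le hiso g hlen x N hN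
  have hcu : c ≤ 100 * δ := by
    have := hlow 1 le_rfl
    simp only [Nat.cast_one, one_mul, pow_one] at this
    linarith
  have hlow2 : ∀ j : ℕ, 2 ^ j * c ≤ dist x (g ^ (2 ^ j) • x) := by
    intro j
    have := hlow (2 ^ j) Nat.one_le_two_pow
    push_cast at this
    exact this
  obtain ⟨j, hj1, hj2⟩ := doubling hδ hc (fun n => dist x (g ^ n • x)) hlow2 (by simpa using hx)
  have hnum := numeric hδ hc hcu j (hlow2 j) hj2
  set h := g ^ (2 ^ j) with hh
  have hmem : ∀ k : ℤ, h ^ k ∈ Subgroup.zpowers g := fun k =>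
    Subgroup.zpow_mem _ (Subgroup.pow_mem _ (Subgroup.mem_zpowers g) _) k
  set P : ℤ → X := fun k => h ^ k • x with hPdef
  have hP0 : P 0 = x := by simp [hPdef]
  have hP : ∀ i j k : ℤ, dist (P (i + k)) (P (j + k)) = dist (P i) (P j) := by
    intro i j k
    simp only [hPdef]
    rw [add_comm i k, add_comm j k, zpow_add, zpow_add, mul_smul, mul_smul, hiso]
  have h2 : dist (P 0) (P 1) + 10 * δ ≤ dist (P 0) (P 2) := by
    have e1 : P 1 = h • x := by simp [hPdef]
    have e2 : P 2 = g ^ (2 ^ j * 2) • x := by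
      rw [pow_mul, ← hh, ← zpow_natCast]; rfl
    rw [hP0, e1, e2]
    exact hj1
  have hn1 : dist (P 0) (P (-1)) = dist (P 0) (P 1) := by
    have := hP 0 (-1) 1
    norm_num at this
    rw [← this, dist_comm]
  have hn2 : dist (P 0) (P (-2)) = dist (P 0) (P 2) := by
    have := hP 0 (-2) 2
    norm_num at this
    rw [← this, dist_comm]
  have cau1 := orbit_cauchy hδ hhyp P hP h2
  have cau2 := orbit_cauchy hδ hhyp (fun i => P (-i))
    (by intro i j k; simpa [neg_add, add_comm] using hP (-i) (-j) (-k))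
    (by simpa [hn1, hn2] using h2)
  have mid := orbit_mid hδ hhyp P hP h2
  simp only [neg_zero] at cau2
  have e1 : P 1 = h • x := by simp [hPdef]
  rw [hP0] at cau1 cau2 mid
  rw [e1] at mid
  obtain ⟨-, -, hbi, hray⟩ := hsg
  obtain ⟨γ₁, hγ₁, hx₁, hc₁⟩ := hray x (fun n : ℕ => P n) cau1
  obtain ⟨γ₂, hγ₂, hx₂, hc₂⟩ := hray x (fun n : ℕ => P (-(n : ℤ))) cau2
  have hna := not_asymp hδ hhyp hγ₁ hγ₂ hx₁ hc₁ hc₂ mid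
  obtain ⟨γ0, hγ0, hcl⟩ := hbi γ₁ γ₂ hγ₁ hγ₂ (hx₁.trans hx₂.symm) hna
  obtain ⟨γ, hγ, hu, hv⟩ := ends_sorted hδ hhyp hγ0 hγ₁ hγ₂ hx₁ hx₂ hc₁ hc₂ hcl
  obtain ⟨z, hz, hd⟩ := near_point hδ hhyp hγ hu hv mid
  refine ⟨z, ?_, hd.trans hnum⟩
  have q := mem_limit (bi_ray hγ) (Subgroup.zpowers g) (fun n => ⟨h ^ (n : ℤ), hmem _⟩) hu
  have p := mem_limit (bi_ray (bi_neg hγ)) (Subgroup.zpowers g)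
    (fun n => ⟨h ^ (-(n : ℤ)), hmem _⟩) hv
  refine Or.inr ⟨_, ⟨_, p, rfl⟩, _, ⟨_, q, rfl⟩, ?_, Set.range γ, ⟨γ, ⟨hγ, ?_, ?_⟩, rfl⟩, hz⟩
  · intro he
    exact ends_ne hγ (Sum.inr_injective he)
  · have := ray_conv (bi_ray (bi_neg hγ))
    simpa using this
  · exact ray_conv (bi_ray hγ)

end KW
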